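/- Let E be a real Banach space and D ⊊ E a c-John domain (c ≥ 1) such that (D, k_D) is Gromov δ-hyperbolic. Fix x, y ∈ D and let γ be a c₀-neargeodesic (c₀ ≥ 1) joining x and y in D. Then there exists a constant A ≥ 1, depending only on c, c₀ and δ, such that: whenever u, v ∈ γ are points for which every w ∈ γ[u,v] satisfies Δ(w) ≤ 2·min{Δ(u), Δ(v)}, one has k_D(u,v) ≤ A. -/

import Mathlib

open Set Metric

noncomputable section

variable {E : Type*} [NormedAddCommGroup E] [NormedSpace ℝ E]

/-- `deltaBd D z` is the distance `Δ(z)` from `z` to the boundary `∂D`. -/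
def deltaBd (D : Set E) (z : E) : ℝ := Metric.infDist z (frontier D)

/-- `γ` is a rectifiable curve in `D`, parametrized by (norm) arclength on `[0, L]`:
it maps `[0, L]` into `D` and the length of the subarc `γ[γ s, γ t]` equals `t - s`. -/
def IsArcLengthParam (D : Set E) (γ : ℝ → E) (L : ℝ) : Prop :=
  0 ≤ L ∧ (∀ t ∈ Icc (0 : ℝ) L, γ t ∈ D) ∧
    ∀ s t : ℝ, 0 ≤ s → s ≤ t → t ≤ L →
      eVariationOn γ (Icc s t) = ENNReal.ofReal (t - s)

/-- The quasihyperbolic length `l_k(γ[γ a, γ b]) = ∫ ds / Δ` of the subarc between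
parameters `a` and `b` of an arclength-parametrized curve `γ` in `D`. -/
def qhLength (D : Set E) (γ : ℝ → E) (a b : ℝ) : ℝ :=
  ∫ t in a..b, 1 / deltaBd D (γ t)

/-- The quasihyperbolic metric `k_D(x,y)`: the infimum of quasihyperbolic lengths of
rectifiable curves in `D` joining `x` and `y`. -/
def qhDist (D : Set E) (x y : E) : ℝ :=
  sInf { l : ℝ | ∃ γ : ℝ → E, ∃ L : ℝ, IsArcLengthParam D γ L ∧
    γ 0 = x ∧ γ L = y ∧ l = qhLength D γ 0 L }

/-- An arclength-parametrized curve `γ : [0,L] → D` joining `x = γ 0` and `y = γ L` is a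
`b`-cone arc if `min (l (γ[x,z])) (l (γ[z,y])) ≤ b * Δ z` for every point `z = γ t` on `γ`. -/
def IsConeArc (D : Set E) (γ : ℝ → E) (L b : ℝ) : Prop :=
  ∀ t ∈ Icc (0 : ℝ) L, min t (L - t) ≤ b * deltaBd D (γ t)

/-- `D` is a `c`-John domain: every pair of points of `D` can be joined by a `c`-cone arc. -/
def IsJohnDomain (D : Set E) (c : ℝ) : Prop :=
  ∀ x ∈ D, ∀ y ∈ D, ∃ γ : ℝ → E, ∃ L : ℝ,
    IsArcLengthParam D γ L ∧ γ 0 = x ∧ γ L = y ∧ IsConeArc D γ L c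

/-- A curve `γ` in `D` is a `c₀`-neargeodesic if `l_k(γ[x,y]) ≤ c₀ * k_D(x,y)` for all
points `x, y` on `γ`. -/
def IsNeargeodesic (D : Set E) (γ : ℝ → E) (L c₀ : ℝ) : Prop :=
  IsArcLengthParam D γ L ∧
    ∀ s t : ℝ, 0 ≤ s → s ≤ t → t ≤ L →
      qhLength D γ s t ≤ c₀ * qhDist D (γ s) (γ t)

/-- The Gromov product `(x|y)_p` with respect to the quasihyperbolic metric on `D`. -/
def gromovProd (D : Set E) (p x y : E) : ℝ :=
  (qhDist D x p + qhDist D y p - qhDist D x y) / 2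

/-- `(D, k_D)` is Gromov `δ`-hyperbolic. -/
def IsGromovHyperbolic (D : Set E) (δ : ℝ) : Prop :=
  ∀ x ∈ D, ∀ y ∈ D, ∀ z ∈ D, ∀ p ∈ D,
    min (gromovProd D p x y) (gromovProd D p y z) - δ ≤ gromovProd D p x z

end

section QuasihyperbolicMetric

variable {E : Type*} [NormedAddCommGroup E] {D : Set E}

theorem deltaBd_pos [NormedSpace ℝ E] (hD : IsOpen D) (hne : D ≠ univ) {z : E} (hz : z ∈ D) :
    0 < deltaBd D z := by
  have hfr : (frontier D).Nonempty := nonempty_frontier_iff.2 ⟨⟨z, hz⟩, hne⟩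
  refine (isClosed_frontier.notMem_iff_infDist_pos hfr).1 fun h => ?_
  rw [hD.frontier_eq] at h
  exact h.2 hz

theorem deltaBd_le_add_dist (x y : E) : deltaBd D x ≤ deltaBd D y + dist x y :=
  infDist_le_infDist_add_dist

theorem IsArcLengthParam.dist_le {γ : ℝ → E} {L s t : ℝ} (h : IsArcLengthParam D γ L)
    (hs : 0 ≤ s) (hst : s ≤ t) (ht : t ≤ L) : dist (γ s) (γ t) ≤ t - s := by
  have h1 := eVariationOn.edist_le γ (left_mem_Icc.2 hst) (right_mem_Icc.2 hst)
  rw [h.2.2 s t hs hst ht, edist_dist] at h1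
  exact (ENNReal.ofReal_le_ofReal_iff (by linarith)).1 h1

theorem IsArcLengthParam.continuousOn {γ : ℝ → E} {L : ℝ} (h : IsArcLengthParam D γ L) :
    ContinuousOn γ (Icc 0 L) := by
  refine LipschitzOnWith.continuousOn (K := 1) (LipschitzOnWith.of_dist_le_mul fun s hs t ht => ?_)
  rw [NNReal.coe_one, one_mul, Real.dist_eq]
  rcases le_total s t with hst | hst
  · rw [abs_sub_comm, abs_of_nonneg (by linarith)]
    exact h.dist_le hs.1 hst ht.2
  · rw [dist_comm, abs_of_nonneg (by linarith)]
    exact h.dist_le ht.1 hst hs.2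

theorem IsArcLengthParam.continuousOn_inv_deltaBd {γ : ℝ → E} {L : ℝ}
    (hpos : ∀ z ∈ D, 0 < deltaBd D z) (h : IsArcLengthParam D γ L) :
    ContinuousOn (fun t => 1 / deltaBd D (γ t)) (Icc 0 L) := by
  have hcont : Continuous (deltaBd D) := continuous_infDist_pt _
  exact continuousOn_const.div (hcont.comp_continuousOn h.continuousOn)
    fun t ht => (hpos _ (h.2.1 t ht)).ne'

theorem IsArcLengthParam.intervalIntegrable {γ : ℝ → E} {L s t : ℝ}
    (hpos : ∀ z ∈ D, 0 < deltaBd D z) (h : IsArcLengthParam D γ L)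
    (hs : 0 ≤ s) (hst : s ≤ t) (ht : t ≤ L) :
    IntervalIntegrable (fun t => 1 / deltaBd D (γ t)) MeasureTheory.volume s t := by
  refine ContinuousOn.intervalIntegrable ?_
  rw [uIcc_of_le hst]
  exact (h.continuousOn_inv_deltaBd hpos).mono (Icc_subset_Icc hs ht)

theorem IsArcLengthParam.qhLength_nonneg {γ : ℝ → E} {L s t : ℝ}
    (hpos : ∀ z ∈ D, 0 < deltaBd D z) (h : IsArcLengthParam D γ L)
    (hs : 0 ≤ s) (hst : s ≤ t) (ht : t ≤ L) : 0 ≤ qhLength D γ s t :=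
  intervalIntegral.integral_nonneg hst fun x hx =>
    (one_div_pos.2 (hpos _ (h.2.1 x ⟨hs.trans hx.1, hx.2.trans ht⟩))).le

theorem IsArcLengthParam.qhLength_add {γ : ℝ → E} {L a b c : ℝ}
    (hpos : ∀ z ∈ D, 0 < deltaBd D z) (h : IsArcLengthParam D γ L)
    (ha : 0 ≤ a) (hab : a ≤ b) (hbc : b ≤ c) (hc : c ≤ L) :
    qhLength D γ a b + qhLength D γ b c = qhLength D γ a c :=
  intervalIntegral.integral_add_adjacent_intervals
    (h.intervalIntegrable hpos ha hab (hbc.trans hc))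
    (h.intervalIntegrable hpos (ha.trans hab) hbc hc)

/-- Every intermediate value of the quasihyperbolic length is attained along a curve. -/
theorem IsArcLengthParam.exists_qhLength_eq {γ : ℝ → E} {L a b v : ℝ}
    (hpos : ∀ z ∈ D, 0 < deltaBd D z) (h : IsArcLengthParam D γ L)
    (ha : 0 ≤ a) (hab : a ≤ b) (hb : b ≤ L) (hv : 0 ≤ v) (hv' : v ≤ qhLength D γ a b) :
    ∃ c ∈ Icc a b, qhLength D γ a c = v := by
  have hI : MeasureTheory.IntegrableOn (fun t => 1 / deltaBd D (γ t)) (uIcc a b) := by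
    rw [uIcc_of_le hab]
    exact ((h.continuousOn_inv_deltaBd hpos).mono (Icc_subset_Icc ha hb)).integrableOn_Icc
  have hcont := intervalIntegral.continuousOn_primitive_interval hI
  rw [uIcc_of_le hab] at hcont
  obtain ⟨c, hc, hcv⟩ := intermediate_value_Icc hab hcont
    (show v ∈ Icc _ _ from ⟨by simpa using hv, hv'⟩)
  exact ⟨c, hc, hcv⟩

theorem IsArcLengthParam.subarc {γ : ℝ → E} {L a b : ℝ} (h : IsArcLengthParam D γ L)
    (ha : 0 ≤ a) (hab : a ≤ b) (hb : b ≤ L) :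
    IsArcLengthParam D (fun t => γ (a + t)) (b - a) := by
  refine ⟨by linarith, fun t ht => h.2.1 _ ⟨by linarith [ht.1], by linarith [ht.2]⟩,
    fun s t hs hst ht => ?_⟩
  have h1 := eVariationOn.comp_eq_of_monotoneOn γ (t := Icc s t) (fun x => a + x)
    (fun x _ y _ hxy => by simpa using hxy)
  rw [image_const_add_Icc, h.2.2 _ _ (by linarith) (by linarith) (by linarith)] at h1
  rw [show t - s = a + t - (a + s) by ring, ← h1]
  rfl

theorem qhLength_subarc (γ : ℝ → E) (a b : ℝ) :
    qhLength D (fun t => γ (a + t)) 0 (b - a) = qhLength D γ a b := by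
  unfold qhLength
  rw [intervalIntegral.integral_comp_add_left (fun x => 1 / deltaBd D (γ x)) a]
  simp

theorem IsArcLengthParam.reverse {γ : ℝ → E} {L : ℝ} (h : IsArcLengthParam D γ L) :
    IsArcLengthParam D (fun t => γ (L - t)) L := by
  refine ⟨h.1, fun t ht => h.2.1 _ ⟨by linarith [ht.2], by linarith [ht.1]⟩,
    fun s t hs hst ht => ?_⟩
  have h1 := eVariationOn.comp_eq_of_antitoneOn γ (t := Icc s t) (fun x => L - x)
    (fun x _ y _ hxy => sub_le_sub_left hxy L)
  rw [image_const_sub_Icc, h.2.2 _ _ (by linarith) (by linarith) (by linarith)] at h1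
  rw [show t - s = L - s - (L - t) by ring, ← h1]
  rfl

theorem IsArcLengthParam.restrict {γ : ℝ → E} {L b : ℝ} (h : IsArcLengthParam D γ L)
    (hb₀ : 0 ≤ b) (hb : b ≤ L) : IsArcLengthParam D γ b :=
  ⟨hb₀, fun t ht => h.2.1 t ⟨ht.1, ht.2.trans hb⟩,
    fun s t hs hst ht => h.2.2 s t hs hst (ht.trans hb)⟩

theorem qhLength_reverse (γ : ℝ → E) (L : ℝ) :
    qhLength D (fun t => γ (L - t)) 0 L = qhLength D γ 0 L := by
  unfold qhLength
  rw [intervalIntegral.integral_comp_sub_left (fun x => 1 / deltaBd D (γ x)) L]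
  simp

theorem IsArcLengthParam.trans {γ₁ γ₂ : ℝ → E} {L₁ L₂ : ℝ} (h₁ : IsArcLengthParam D γ₁ L₁)
    (h₂ : IsArcLengthParam D γ₂ L₂) (h : γ₁ L₁ = γ₂ 0) :
    IsArcLengthParam D (fun t => if t ≤ L₁ then γ₁ t else γ₂ (t - L₁)) (L₁ + L₂) := by
  set η : ℝ → E := fun t => if t ≤ L₁ then γ₁ t else γ₂ (t - L₁) with hη
  have hL₁ := h₁.1
  have hL₂ := h₂.1
  have hle : ∀ t, t ≤ L₁ → η t = γ₁ t := fun t ht => if_pos ht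
  have hge : ∀ t, L₁ ≤ t → η t = γ₂ (-L₁ + t) := by
    intro t ht
    rcases ht.eq_or_lt with rfl | ht
    · simp [hη, h]
    · rw [hη, neg_add_eq_sub]
      exact if_neg (not_le.2 ht)
  have hvl : ∀ s t, 0 ≤ s → s ≤ t → t ≤ L₁ →
      eVariationOn η (Icc s t) = ENNReal.ofReal (t - s) := by
    intro s t hs hst ht
    rw [← h₁.2.2 s t hs hst ht]
    exact eVariationOn.eq_of_eqOn fun x hx => hle x (hx.2.trans ht)
  have hvr : ∀ s t, L₁ ≤ s → s ≤ t → t ≤ L₁ + L₂ →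
      eVariationOn η (Icc s t) = ENNReal.ofReal (t - s) := by
    intro s t hs hst ht
    have h1 := eVariationOn.comp_eq_of_monotoneOn γ₂ (t := Icc s t) (fun x => -L₁ + x)
      (fun x _ y _ hxy => by simpa using hxy)
    rw [image_const_add_Icc, h₂.2.2 _ _ (by linarith) (by linarith) (by linarith)] at h1
    rw [show t - s = -L₁ + t - (-L₁ + s) by ring, ← h1]
    exact eVariationOn.eq_of_eqOn fun x hx => hge x (hs.trans hx.1)
  refine ⟨by linarith, fun t ht => ?_, fun s t hs hst ht => ?_⟩
  · rcases le_total t L₁ with htl | htl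
    · rw [hle t htl]
      exact h₁.2.1 t ⟨ht.1, htl⟩
    · rw [hge t htl]
      exact h₂.2.1 _ ⟨by linarith, by linarith [ht.2]⟩
  · rcases le_total t L₁ with htl | htl
    · exact hvl s t hs hst htl
    rcases le_total L₁ s with hsl | hsl
    · exact hvr s t hsl hst ht
    have h1 := eVariationOn.Icc_add_Icc η (s := univ) hsl htl (mem_univ _)
    simp only [univ_inter] at h1
    rw [← h1, hvl s L₁ hs hsl le_rfl, hvr L₁ t le_rfl htl ht,
      ← ENNReal.ofReal_add (by linarith) (by linarith)]
    congr 1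
    ring

theorem IsArcLengthParam.qhLength_trans {γ₁ γ₂ : ℝ → E} {L₁ L₂ : ℝ}
    (hpos : ∀ z ∈ D, 0 < deltaBd D z) (h₁ : IsArcLengthParam D γ₁ L₁)
    (h₂ : IsArcLengthParam D γ₂ L₂) (h : γ₁ L₁ = γ₂ 0) :
    qhLength D (fun t => if t ≤ L₁ then γ₁ t else γ₂ (t - L₁)) 0 (L₁ + L₂) =
      qhLength D γ₁ 0 L₁ + qhLength D γ₂ 0 L₂ := by
  have hL₁ := h₁.1
  have hL₂ := h₂.1
  rw [← (h₁.trans h₂ h).qhLength_add hpos le_rfl hL₁ (le_add_of_nonneg_right hL₂) le_rfl]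
  congr 1
  · refine intervalIntegral.integral_congr fun t ht => ?_
    rw [uIcc_of_le hL₁] at ht
    simp [ht.2]
  · rw [← qhLength_subarc (D := D) _ L₁ (L₁ + L₂), add_sub_cancel_left]
    refine intervalIntegral.integral_congr fun t ht => ?_
    rw [uIcc_of_le hL₂] at ht
    rcases ht.1.eq_or_lt with rfl | ht0
    · simp [h]
    · simp [not_le.2 ht0]

theorem qhDist_le_of_curve (hpos : ∀ z ∈ D, 0 < deltaBd D z) {γ : ℝ → E} {L : ℝ}
    (h : IsArcLengthParam D γ L) : qhDist D (γ 0) (γ L) ≤ qhLength D γ 0 L := by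
  refine csInf_le ⟨0, ?_⟩ ⟨γ, L, h, rfl, rfl, rfl⟩
  rintro l ⟨η, M, hη, -, -, rfl⟩
  exact hη.qhLength_nonneg hpos le_rfl hη.1 le_rfl

theorem qhDist_le_qhLength (hpos : ∀ z ∈ D, 0 < deltaBd D z) {γ : ℝ → E} {L a b : ℝ}
    (h : IsArcLengthParam D γ L) (ha : 0 ≤ a) (hab : a ≤ b) (hb : b ≤ L) :
    qhDist D (γ a) (γ b) ≤ qhLength D γ a b := by
  have h1 := qhDist_le_of_curve hpos (h.subarc ha hab hb)
  rw [qhLength_subarc] at h1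
  simpa using h1

theorem qhDist_comm (x y : E) : qhDist D x y = qhDist D y x := by
  have key : ∀ x y : E, { l : ℝ | ∃ γ : ℝ → E, ∃ L : ℝ, IsArcLengthParam D γ L ∧
      γ 0 = x ∧ γ L = y ∧ l = qhLength D γ 0 L } ⊆ { l : ℝ | ∃ γ : ℝ → E, ∃ L : ℝ,
      IsArcLengthParam D γ L ∧ γ 0 = y ∧ γ L = x ∧ l = qhLength D γ 0 L } := by
    rintro x y l ⟨γ, L, h, h0, hL, rfl⟩
    exact ⟨_, L, h.reverse, by simpa using hL, by simpa using h0, (qhLength_reverse γ L).symm⟩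
  exact congrArg sInf (Subset.antisymm (key x y) (key y x))

theorem exists_curve_qhLength_lt {x y : E}
    (hxy : ∃ γ : ℝ → E, ∃ L : ℝ, IsArcLengthParam D γ L ∧ γ 0 = x ∧ γ L = y)
    {r : ℝ} (hr : qhDist D x y < r) :
    ∃ γ : ℝ → E, ∃ L : ℝ, IsArcLengthParam D γ L ∧ γ 0 = x ∧ γ L = y ∧ qhLength D γ 0 L < r := by
  obtain ⟨γ, L, h, h0, hL⟩ := hxy
  have hne : { l : ℝ | ∃ γ : ℝ → E, ∃ L : ℝ, IsArcLengthParam D γ L ∧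
    γ 0 = x ∧ γ L = y ∧ l = qhLength D γ 0 L }.Nonempty := ⟨_, γ, L, h, h0, hL, rfl⟩
  obtain ⟨l, ⟨η, M, hη, hη0, hηM, rfl⟩, hl⟩ := exists_lt_of_csInf_lt hne hr
  exact ⟨η, M, hη, hη0, hηM, hl⟩

theorem gromovProd_comm (p x y : E) : gromovProd D p x y = gromovProd D p y x := by
  rw [gromovProd, gromovProd, qhDist_comm x y]
  ring

/-- The quasihyperbolic metric has approximate midpoints. -/
theorem exists_approx_midpoint (hpos : ∀ z ∈ D, 0 < deltaBd D z) {x y : E}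
    (hxy : ∃ γ : ℝ → E, ∃ L : ℝ, IsArcLengthParam D γ L ∧ γ 0 = x ∧ γ L = y) :
    ∃ m ∈ D, qhDist D x m ≤ (qhDist D x y + 1) / 2 ∧ qhDist D m y ≤ (qhDist D x y + 1) / 2 := by
  obtain ⟨β, M, hβ, rfl, rfl, hl⟩ := exists_curve_qhLength_lt hxy (lt_add_one _)
  have hM := hβ.1
  have hnn := hβ.qhLength_nonneg hpos le_rfl hM le_rfl
  obtain ⟨e, he, hev⟩ := hβ.exists_qhLength_eq hpos le_rfl hM le_rfl
    (v := qhLength D β 0 M / 2) (by linarith) (by linarith)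
  have hadd := hβ.qhLength_add hpos le_rfl he.1 he.2 le_rfl
  have h1 := qhDist_le_qhLength hpos hβ le_rfl he.1 he.2
  have h2 := qhDist_le_qhLength hpos hβ he.1 he.2 le_rfl
  exact ⟨β e, hβ.2.1 e he, by linarith, by linarith⟩

theorem qhDist_triangle (hpos : ∀ z ∈ D, 0 < deltaBd D z)
    (hcon : ∀ x ∈ D, ∀ y ∈ D, ∃ γ : ℝ → E, ∃ L : ℝ, IsArcLengthParam D γ L ∧ γ 0 = x ∧ γ L = y)
    {x y z : E} (hx : x ∈ D) (hy : y ∈ D) (hz : z ∈ D) :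
    qhDist D x z ≤ qhDist D x y + qhDist D y z := by
  refine le_of_forall_pos_lt_add fun ε hε => ?_
  obtain ⟨γ₁, L₁, h₁, h₁0, h₁L, hl₁⟩ := exists_curve_qhLength_lt (hcon x hx y hy)
    (show qhDist D x y < qhDist D x y + ε / 2 by linarith)
  obtain ⟨γ₂, L₂, h₂, h₂0, h₂L, hl₂⟩ := exists_curve_qhLength_lt (hcon y hy z hz)
    (show qhDist D y z < qhDist D y z + ε / 2 by linarith)
  have hj : γ₁ L₁ = γ₂ 0 := by rw [h₁L, h₂0]
  have h := qhDist_le_of_curve hpos (h₁.trans h₂ hj)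
  rw [h₁.qhLength_trans hpos h₂ hj] at h
  have e0 : (if (0 : ℝ) ≤ L₁ then γ₁ 0 else γ₂ (0 - L₁)) = x := by rw [if_pos h₁.1, h₁0]
  have e1 : (if L₁ + L₂ ≤ L₁ then γ₁ (L₁ + L₂) else γ₂ (L₁ + L₂ - L₁)) = z := by
    rcases h₂.1.eq_or_lt with h0 | h0
    · rw [← h0, add_zero, if_pos le_rfl, hj, ← h₂L, ← h0]
    · rw [if_neg (by linarith), add_sub_cancel_left, h₂L]
  rw [e0, e1] at h
  linarith

theorem log_deltaBd_div_le_qhLength (hpos : ∀ z ∈ D, 0 < deltaBd D z) {γ : ℝ → E} {L : ℝ}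
    (h : IsArcLengthParam D γ L) :
    Real.log (deltaBd D (γ L) / deltaBd D (γ 0)) ≤ qhLength D γ 0 L := by
  have hL := h.1
  have h0 : 0 < deltaBd D (γ 0) := hpos _ (h.2.1 0 ⟨le_rfl, hL⟩)
  have hLpos : 0 < deltaBd D (γ L) := hpos _ (h.2.1 L ⟨hL, le_rfl⟩)
  have hgrow : ∀ t ∈ Icc 0 L, deltaBd D (γ t) ≤ deltaBd D (γ 0) + t := by
    intro t ht
    have h1 := deltaBd_le_add_dist (D := D) (γ t) (γ 0)
    have h2 := h.dist_le le_rfl ht.1 ht.2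
    rw [dist_comm] at h1
    linarith
  calc Real.log (deltaBd D (γ L) / deltaBd D (γ 0))
      ≤ Real.log ((deltaBd D (γ 0) + L) / deltaBd D (γ 0)) := by
        gcongr
        exact hgrow L ⟨hL, le_rfl⟩
    _ = ∫ t in (0 : ℝ)..L, 1 / (deltaBd D (γ 0) + t) := by
        rw [intervalIntegral.integral_comp_add_left (fun x : ℝ => 1 / x),
          integral_one_div_of_pos (by linarith) (by linarith), add_zero]
    _ ≤ qhLength D γ 0 L := by
        refine intervalIntegral.integral_mono_on hL ?_
          (h.intervalIntegrable hpos le_rfl hL le_rfl) fun t ht => ?_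
        · refine ContinuousOn.intervalIntegrable ?_
          rw [uIcc_of_le hL]
          refine continuousOn_const.div (by fun_prop) fun t ht => ?_
          have := ht.1
          positivity
        · exact one_div_le_one_div_of_le (hpos _ (h.2.1 t ht)) (hgrow t ht)

theorem log_deltaBd_div_le_qhDist (hpos : ∀ z ∈ D, 0 < deltaBd D z)
    (hcon : ∀ x ∈ D, ∀ y ∈ D, ∃ γ : ℝ → E, ∃ L : ℝ, IsArcLengthParam D γ L ∧ γ 0 = x ∧ γ L = y)
    {x y : E} (hx : x ∈ D) (hy : y ∈ D) :
    Real.log (deltaBd D y / deltaBd D x) ≤ qhDist D x y := by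
  obtain ⟨γ, L, h, h0, hL⟩ := hcon x hx y hy
  refine le_csInf ⟨_, γ, L, h, h0, hL, rfl⟩ ?_
  rintro l ⟨η, M, hη, rfl, rfl, rfl⟩
  exact log_deltaBd_div_le_qhLength hpos hη

/-- In a hyperbolic domain, every curve comes logarithmically close, in terms of its
quasihyperbolic length, to any point at which its endpoints have small Gromov product. -/
theorem exists_qhDist_le_of_qhLength_le (hpos : ∀ z ∈ D, 0 < deltaBd D z) {δ : ℝ}
    (hyp : IsGromovHyperbolic D δ)
    (hcon : ∀ x ∈ D, ∀ y ∈ D, ∃ γ : ℝ → E, ∃ L : ℝ, IsArcLengthParam D γ L ∧ γ 0 = x ∧ γ L = y)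
    {γ : ℝ → E} {L : ℝ} (h : IsArcLengthParam D γ L) {m : E} (hm : m ∈ D) (k : ℕ) :
    ∀ a b : ℝ, 0 ≤ a → a ≤ b → b ≤ L → qhLength D γ a b ≤ 2 ^ k →
      ∃ p ∈ Icc a b, qhDist D (γ p) m ≤ gromovProd D m (γ a) (γ b) + 1 + k * δ := by
  induction k with
  | zero =>
    intro a b ha hab hb hl
    have hγa : γ a ∈ D := h.2.1 a ⟨ha, hab.trans hb⟩
    have hγb : γ b ∈ D := h.2.1 b ⟨ha.trans hab, hb⟩
    refine ⟨a, ⟨le_rfl, hab⟩, ?_⟩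
    have h1 := qhDist_le_qhLength hpos h ha hab hb
    have h2 := qhDist_triangle hpos hcon hγa hγb hm
    simp only [gromovProd, pow_zero, Nat.cast_zero] at *
    linarith
  | succ k ih =>
    intro a b ha hab hb hl
    have hnn := h.qhLength_nonneg hpos ha hab hb
    obtain ⟨e, he, hev⟩ := h.exists_qhLength_eq hpos ha hab hb (v := qhLength D γ a b / 2)
      (by linarith) (by linarith)
    have hadd := h.qhLength_add hpos ha he.1 he.2 hb
    rw [pow_succ] at hl
    have hg := hyp (γ a) (h.2.1 a ⟨ha, hab.trans hb⟩) (γ e)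
      (h.2.1 e ⟨ha.trans he.1, he.2.trans hb⟩) (γ b) (h.2.1 b ⟨ha.trans hab, hb⟩) m hm
    push_cast
    rcases min_le_iff.1 (sub_le_iff_le_add.1 hg) with hg | hg
    · obtain ⟨p, hp, hpm⟩ := ih a e ha he.1 (he.2.trans hb) (by linarith)
      exact ⟨p, ⟨hp.1, hp.2.trans he.2⟩, by linarith⟩
    · obtain ⟨p, hp, hpm⟩ := ih e b (ha.trans he.1) he.2 hb (by linarith)
      exact ⟨p, ⟨he.1.trans hp.1, hp.2⟩, by linarith⟩

theorem IsGromovHyperbolic.exists_gromovProd_le {δ : ℝ} (hδ : 0 ≤ δ)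
    (hyp : IsGromovHyperbolic D δ) {m : E} (hm : m ∈ D) (n : ℕ) :
    ∀ x : ℕ → E, (∀ i, x i ∈ D) → ∃ i ≤ n,
      gromovProd D m (x i) (x (i + 1)) ≤ gromovProd D m (x 0) (x (n + 1)) + (i + 1) * δ := by
  induction n with
  | zero => exact fun x _ => ⟨0, le_rfl, by simpa using hδ⟩
  | succ n ih =>
    intro x hx
    have hg := hyp (x 0) (hx 0) (x 1) (hx 1) (x (n + 1 + 1)) (hx _) m hm
    rcases min_le_iff.1 (sub_le_iff_le_add.1 hg) with hg | hg
    · exact ⟨0, Nat.zero_le _, by simpa using hg⟩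
    · obtain ⟨i, hi, him⟩ := ih (fun i => x (i + 1)) fun i => hx _
      refine ⟨i + 1, by lia, ?_⟩
      push_cast
      simp only [zero_add] at him
      linarith

/-- Along a curve `α` issuing from `u` and satisfying a one-sided cone condition, the
quasihyperbolic distance from `u` to a point `m` is controlled by the Gromov product at `m` of the
endpoints of `α` and by the size of `Δ m / Δ u`. -/
theorem qhDist_le_of_cone (hpos : ∀ z ∈ D, 0 < deltaBd D z) {c δ : ℝ} (hc : 0 ≤ c) (hδ : 0 ≤ δ)
    (hyp : IsGromovHyperbolic D δ)
    (hcon : ∀ x ∈ D, ∀ y ∈ D, ∃ γ : ℝ → E, ∃ L : ℝ, IsArcLengthParam D γ L ∧ γ 0 = x ∧ γ L = y)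
    {α : ℝ → E} {M : ℝ} (h : IsArcLengthParam D α M)
    (hcone : ∀ t ∈ Icc 0 M, t ≤ c * deltaBd D (α t)) {m : E} (hm : m ∈ D) {q g H : ℝ}
    (hq : Real.log (deltaBd D m / deltaBd D (α 0)) ≤ q)
    (hg : gromovProd D m (α 0) (α M) ≤ g) (hH : H = (1 + 2 * c) * (Real.exp (δ + 1) - 1)) :
    qhDist D (α 0) m ≤ (g + q + δ + H + Real.log (1 + 2 * c) + 1) * (H + δ) + g := by
  have hM := h.1
  have h0D : α 0 ∈ D := h.2.1 0 ⟨le_rfl, hM⟩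
  set r := deltaBd D (α 0) with hr
  have hr0 : 0 < r := hpos _ h0D
  set lam := Real.exp (δ + 1) with hlam
  have hlam1 : 1 < lam := Real.one_lt_exp_iff.2 (by linarith)
  have hlampow : ∀ i : ℕ, 1 ≤ lam ^ i := fun i => one_le_pow₀ hlam1.le
  have hH0 : 0 ≤ H := hH ▸ mul_nonneg (by linarith) (by linarith)
  have hgrow : ∀ t ∈ Icc 0 M, r + t ≤ (1 + 2 * c) * deltaBd D (α t) := by
    intro t ht
    have h1 := deltaBd_le_add_dist (D := D) (α 0) (α t)
    have h2 := h.dist_le le_rfl ht.1 ht.2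
    have h3 := hcone t ht
    rw [← hr] at h1
    linarith
  have hex : ∃ n : ℕ, M ≤ r * (lam ^ (n + 1) - 1) := by
    obtain ⟨n, hn⟩ := pow_unbounded_of_one_lt (M / r + 1) hlam1
    refine ⟨n, ?_⟩
    have h1 : lam ^ n ≤ lam ^ (n + 1) := pow_le_pow_right₀ hlam1.le n.le_succ
    have h2 : M / r ≤ lam ^ (n + 1) - 1 := by linarith
    rwa [div_le_iff₀' hr0] at h2
  classical
  obtain ⟨n, hn, hmin⟩ : ∃ n : ℕ, M ≤ r * (lam ^ (n + 1) - 1) ∧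
      ∀ i ≤ n, r * (lam ^ i - 1) ≤ M := by
    refine ⟨Nat.find hex, Nat.find_spec hex, fun i hi => ?_⟩
    cases i with
    | zero => simpa using hM
    | succ j => exact (not_le.1 (Nat.find_min hex hi)).le
  set τ : ℕ → ℝ := fun i => min (r * (lam ^ i - 1)) M with hτ
  have hτ0 : τ 0 = 0 := by simp [hτ, hM]
  have hτn : τ (n + 1) = M := min_eq_right hn
  have hτi : ∀ i ≤ n, τ i = r * (lam ^ i - 1) := fun i hi => min_eq_left (hmin i hi)
  have hτmem : ∀ i, τ i ∈ Icc 0 M := fun i =>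
    ⟨le_min (mul_nonneg hr0.le (by linarith [hlampow i])) hM, min_le_right _ _⟩
  have hτmono : ∀ i, τ i ≤ τ (i + 1) := fun i => by
    have := pow_le_pow_right₀ hlam1.le i.le_succ
    simp only [hτ]
    gcongr
  have hxD : ∀ i, α (τ i) ∈ D := fun i => h.2.1 _ (hτmem i)
  have hstep : ∀ i ≤ n, qhDist D (α (τ i)) (α (τ (i + 1))) ≤ H := by
    intro i hi
    refine (qhDist_le_qhLength hpos h (hτmem i).1 (hτmono i) (hτmem _).2).trans ?_
    have hp : 0 < r * lam ^ i := mul_pos hr0 (by linarith [hlampow i])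
    have hbound : ∀ t ∈ uIoc (τ i) (τ (i + 1)),
        ‖1 / deltaBd D (α t)‖ ≤ (1 + 2 * c) / (r * lam ^ i) := by
      intro t ht
      rw [uIoc_of_le (hτmono i)] at ht
      have htm : t ∈ Icc 0 M := ⟨(hτmem i).1.trans ht.1.le, ht.2.trans (hτmem _).2⟩
      have hd := hpos _ (h.2.1 t htm)
      rw [Real.norm_of_nonneg (one_div_pos.2 hd).le, div_le_div_iff₀ hd hp]
      have h1 := hgrow t htm
      have h2 := ht.1
      rw [hτi i hi] at h2
      linarith
    have h1 := intervalIntegral.norm_integral_le_of_norm_le_const hbound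
    refine (le_abs_self _).trans (h1.trans ?_)
    rw [abs_of_nonneg (by linarith [hτmono i]), div_mul_eq_mul_div, div_le_iff₀ hp, hH]
    have h2 : τ (i + 1) ≤ r * (lam ^ (i + 1) - 1) := min_le_left _ _
    have h3 : τ (i + 1) - τ i ≤ (lam - 1) * (r * lam ^ i) := by
      rw [hτi i hi]
      rw [pow_succ] at h2
      linarith
    calc (1 + 2 * c) * (τ (i + 1) - τ i) ≤ (1 + 2 * c) * ((lam - 1) * (r * lam ^ i)) := by gcongr
      _ = _ := by ring
  have hself : qhDist D (α 0) (α 0) ≤ 0 := by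
    simpa [qhLength] using qhDist_le_qhLength hpos h le_rfl le_rfl hM
  have hdist : ∀ i ≤ n, qhDist D (α 0) (α (τ i)) ≤ i * H := by
    intro i
    induction i with
    | zero => simpa [hτ0] using hself
    | succ i ih =>
      intro hi
      have h1 := ih (by lia)
      have h2 := hstep i (by lia)
      have h3 := qhDist_triangle hpos hcon h0D (hxD i) (hxD (i + 1))
      push_cast
      linarith
  obtain ⟨i, hi, hgi⟩ := hyp.exists_gromovProd_le hδ hm n (fun i => α (τ i)) hxD
  simp only [hτ0, hτn] at hgi
  have hnear : qhDist D (α (τ i)) m ≤ g + (i + 1) * δ + H := by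
    have h1 := hstep i hi
    have h2 := qhDist_triangle hpos hcon (hxD i) (hxD (i + 1)) hm
    simp only [gromovProd] at hgi hg
    linarith
  have hfar : (i : ℝ) * (δ + 1) - Real.log (1 + 2 * c) - q ≤ qhDist D (α (τ i)) m := by
    have hdm := hpos m hm
    have hdi := hpos _ (hxD i)
    have h1 := log_deltaBd_div_le_qhDist hpos hcon hm (hxD i)
    rw [qhDist_comm, Real.log_div hdi.ne' hdm.ne'] at h1
    rw [Real.log_div hdm.ne' hr0.ne'] at hq
    have h2 := hgrow _ (hτmem i)
    have h3 : r * lam ^ i ≤ (1 + 2 * c) * deltaBd D (α (τ i)) := by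
      have := hτi i hi
      linarith
    have h4 := Real.log_le_log (mul_pos hr0 (by linarith [hlampow i])) h3
    rw [Real.log_mul hr0.ne' (by linarith [hlampow i] : 0 < lam ^ i).ne', Real.log_pow,
      Real.log_mul (by linarith) hdi.ne', hlam, Real.log_exp] at h4
    linarith
  have hi' : (i : ℝ) + 1 ≤ g + q + δ + H + Real.log (1 + 2 * c) + 1 := by linarith
  have h1 := hdist i hi
  have h2 := qhDist_triangle hpos hcon h0D (hxD i) hm
  have h3 := mul_le_mul_of_nonneg_right hi' (add_nonneg hH0 hδ)
  linarith

end QuasihyperbolicMetric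

theorem exists_bound_of_two_pow_le (a b : ℝ) :
    ∃ N : ℕ, ∀ n : ℕ, (2 : ℝ) ^ n ≤ a + b * n → n ≤ N := by
  have h1 : Filter.Tendsto (fun n : ℕ => a * ((n : ℝ) ^ 0 / 2 ^ n) + b * ((n : ℝ) ^ 1 / 2 ^ n))
      Filter.atTop (nhds (a * 0 + b * 0)) :=
    ((tendsto_pow_const_div_const_pow_of_one_lt 0 one_lt_two).const_mul a).add
      ((tendsto_pow_const_div_const_pow_of_one_lt 1 one_lt_two).const_mul b)
  have h2 := h1.eventually_lt_const (show a * 0 + b * 0 < (1 : ℝ) by simp)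
  obtain ⟨N, hN⟩ := Filter.eventually_atTop.1 h2
  refine ⟨N, fun n hn => le_of_not_gt fun hlt => ?_⟩
  have h3 := hN n hlt.le
  have hp : (0 : ℝ) < 2 ^ n := by positivity
  rw [pow_zero, pow_one, mul_div_assoc', mul_div_assoc', ← add_div, div_lt_one hp] at h3
  linarith

/-- Let `E` be a real Banach space and `D ⊊ E` a `c`-John domain (`c ≥ 1`)
such that `(D, k_D)` is Gromov `δ`-hyperbolic. Fix `x, y ∈ D` and let `γ` be a
`c₀`-neargeodesic (`c₀ ≥ 1`) joining `x` and `y` in `D`. Then there exists `A ≥ 1`,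
depending only on `c, c₀, δ`, such that whenever `u = γ s`, `v = γ t` are points of `γ`
for which every `w ∈ γ[u,v]` satisfies `Δ(w) ≤ 2 * min (Δ u) (Δ v)`, one has `k_D(u,v) ≤ A`. -/
theorem qhDist_bound_on_neargeodesics_in_GH_John_domains
    (c c₀ δ : ℝ) (hc : 1 ≤ c) (hc₀ : 1 ≤ c₀) (hδ : 0 ≤ δ) :
    ∃ A : ℝ, 1 ≤ A ∧
      ∀ (E : Type*) [NormedAddCommGroup E] [NormedSpace ℝ E] [CompleteSpace E]
        (D : Set E), IsOpen D → IsConnected D → D ≠ Set.univ →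
        IsJohnDomain D c → IsGromovHyperbolic D δ →
        ∀ x ∈ D, ∀ y ∈ D, ∀ (γ : ℝ → E) (L : ℝ),
          IsNeargeodesic D γ L c₀ → γ 0 = x → γ L = y →
          ∀ s t : ℝ, 0 ≤ s → s ≤ t → t ≤ L →
            (∀ w ∈ Icc s t, deltaBd D (γ w) ≤ 2 * min (deltaBd D (γ s)) (deltaBd D (γ t))) →
            qhDist D (γ s) (γ t) ≤ A := by
  obtain ⟨H, hH⟩ : ∃ H : ℝ, H = (1 + 2 * c) * (Real.exp (δ + 1) - 1) := ⟨_, rfl⟩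
  obtain ⟨g, hg⟩ : ∃ g : ℝ, g = 1 / 2 + δ := ⟨_, rfl⟩
  obtain ⟨q, hq⟩ : ∃ q : ℕ → ℝ, ∀ n, q n = 3 + (n + 1) * δ := ⟨_, fun _ => rfl⟩
  obtain ⟨S, hS⟩ : ∃ S : ℕ → ℝ,
      ∀ n, S n = (g + q n + δ + H + Real.log (1 + 2 * c) + 1) * (H + δ) + g := ⟨_, fun _ => rfl⟩
  have hH0 : 0 ≤ H := by
    rw [hH]
    have := Real.one_lt_exp_iff.2 (show 0 < δ + 1 by linarith)
    exact mul_nonneg (by linarith) (by linarith)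
  have hSmono : ∀ n N : ℕ, n ≤ N → S n ≤ S N := by
    intro n N hnN
    have : (n : ℝ) ≤ N := by exact_mod_cast hnN
    rw [hS, hS, hq, hq]
    gcongr
  obtain ⟨N, hN⟩ := exists_bound_of_two_pow_le (c₀ * (2 * S 0 + 1) + 1)
    (2 * c₀ * (δ * (H + δ)))
  refine ⟨max 1 (2 * S N + 1), le_max_left _ _, ?_⟩
  intro E _ _ _ D hDo _ hDne hJohn hyp x _ y _ γ L hγ _ _ s t hs hst ht hw
  have hpos : ∀ z ∈ D, 0 < deltaBd D z := fun z hz => deltaBd_pos hDo hDne hz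
  have hcon : ∀ x ∈ D, ∀ y ∈ D, ∃ γ : ℝ → E, ∃ L : ℝ,
      IsArcLengthParam D γ L ∧ γ 0 = x ∧ γ L = y := fun x hx y hy =>
    let ⟨γ, L, h, h0, hL, _⟩ := hJohn x hx y hy
    ⟨γ, L, h, h0, hL⟩
  have hu : γ s ∈ D := hγ.1.2.1 s ⟨hs, hst.trans ht⟩
  have hv : γ t ∈ D := hγ.1.2.1 t ⟨hs.trans hst, ht⟩
  obtain ⟨m, hm, hum, hmv⟩ := exists_approx_midpoint hpos (hcon _ hu _ hv)
  have hlen := hγ.2 s t hs hst ht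
  have hlen0 := hγ.1.qhLength_nonneg hpos hs hst ht
  obtain ⟨n, hn1, hn2⟩ := exists_nat_pow_near
    (show 1 ≤ c₀ * qhDist D (γ s) (γ t) + 1 by linarith) one_lt_two
  have huvm : gromovProd D m (γ s) (γ t) ≤ 1 / 2 := by
    rw [gromovProd, qhDist_comm (γ t) m]
    linarith
  have hqb : ∀ w ∈ D, (∀ p ∈ Icc s t, deltaBd D (γ p) ≤ 2 * deltaBd D w) →
      Real.log (deltaBd D m / deltaBd D w) ≤ q n := by
    intro w hwD hpw
    obtain ⟨p, hp, hpm⟩ := exists_qhDist_le_of_qhLength_le hpos hyp hcon hγ.1 hm (n + 1) s t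
      hs hst ht (by linarith)
    have hpD : γ p ∈ D := hγ.1.2.1 p ⟨hs.trans hp.1, hp.2.trans ht⟩
    have h1 := log_deltaBd_div_le_qhDist hpos hcon hpD hm
    have h2 := Real.log_le_log (hpos _ hpD) (hpw p hp)
    have h3 := Real.log_two_lt_d9
    rw [Real.log_mul two_ne_zero (hpos _ hwD).ne'] at h2
    rw [Real.log_div (hpos _ hm).ne' (hpos _ hpD).ne'] at h1
    rw [Real.log_div (hpos _ hm).ne' (hpos _ hwD).ne', hq]
    push_cast at hpm
    linarith
  have hbound : qhDist D (γ s) (γ t) ≤ 2 * S n + 1 := by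
    obtain ⟨α, l, hα, hα0, hαl, hcone⟩ := hJohn _ hu _ hv
    have hl := hα.1
    have hz : α (l / 2) ∈ D := hα.2.1 _ ⟨by linarith, by linarith⟩
    have htri := qhDist_triangle hpos hcon hu hm hv
    have hsplit := hyp _ hu _ hz _ hv m hm
    rcases min_le_iff.1 (sub_le_iff_le_add.1 hsplit) with hsplit | hsplit
    · have h1 := qhDist_le_of_cone hpos (by linarith) hδ hyp hcon
        (hα.restrict (b := l / 2) (by linarith) (by linarith)) (fun r hr => ?_) hm
        (q := q n) (g := g) ?_ ?_ hH
      · rw [hα0, ← hS] at h1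
        linarith
      · have h2 := hcone r ⟨hr.1, by linarith [hr.2]⟩
        rwa [min_eq_left (by linarith [hr.2])] at h2
      · rw [hα0]
        exact hqb _ hu fun p hp => (hw p hp).trans (by gcongr; exact min_le_left _ _)
      · rw [hα0]
        linarith
    · have h1 := qhDist_le_of_cone hpos (by linarith) hδ hyp hcon
        (hα.reverse.restrict (b := l / 2) (by linarith) (by linarith)) (fun r hr => ?_) hm
        (q := q n) (g := g) ?_ ?_ hH
      · rw [sub_zero, hαl, ← hS, qhDist_comm] at h1
        linarith
      · have h2 := hcone (l - r) ⟨by linarith [hr.2], by linarith [hr.1]⟩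
        rwa [min_eq_right (by linarith [hr.2]), sub_sub_cancel] at h2
      · rw [sub_zero, hαl]
        exact hqb _ hv fun p hp => (hw p hp).trans (by gcongr; exact min_le_right _ _)
      · rw [sub_zero, hαl, sub_half, gromovProd_comm]
        linarith
  have hnN : n ≤ N := by
    refine hN n (hn1.trans ?_)
    have h1 : c₀ * qhDist D (γ s) (γ t) ≤ c₀ * (2 * S n + 1) := by gcongr
    have h2 : S n = S 0 + δ * (H + δ) * n := by
      rw [hS, hS, hq, hq]
      push_cast
      ring
    rw [h2] at h1
    linarith
  exact hbound.trans (le_max_of_le_right (by linarith [hSmono n N hnN]))
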